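/- (Identifiability with a sub-band structured basis and sparse signal.) Let E ∈ ℂ^{n×m₂} form a sub-band structured basis with bandwidths ℓ_k satisfying ∑_{k=1}^{m₂} ℓ_k ≥ 2s₁ + m₂ − 1. Let x₀ ∈ ℂ^{m₁} with ‖x₀‖₀ ≤ s₁, x₀ ≠ 0, and let y₀ ∈ ℂ^{m₂} be non-vanishing. Then for almost all D ∈ ℂ^{n×m₁}, any (x,y) with ‖x‖₀ ≤ s₁ and (Dx) ⊛ (Ey) = (Dx₀) ⊛ (Ey₀) satisfies x = σx₀, y = σ^{-1}y₀ for some nonzero σ ∈ ℂ. -/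

import Mathlib

open MeasureTheory

/-- Circular convolution of two vectors in `ℂ^n`. -/
noncomputable def cconv {n : ℕ} (u v : Fin n → ℂ) : Fin n → ℂ :=
  fun i => ∑ j, u j * v (i - j)

/-- The normalized DFT matrix, `(F_n)_{jk} = n^{-1/2} e^{-2πi jk/n}`. -/
noncomputable def dft (n : ℕ) : Fin n → Fin n → ℂ :=
  fun j k => ((Real.sqrt n : ℝ) : ℂ)⁻¹ *
    Complex.exp (-(2 * (Real.pi : ℂ) * Complex.I * ((j : ℕ) : ℂ) * ((k : ℕ) : ℂ)) / (n : ℂ))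

/-- Matrix-vector multiplication. -/
noncomputable def mulVecF {n m : ℕ} (A : Fin n → Fin m → ℂ) (x : Fin m → ℂ) : Fin n → ℂ :=
  fun i => ∑ j, A i j * x j

/-- `J_k`: support of the `k`-th column of `Ẽ = F_nE`. -/
noncomputable def subbandSupport {n m₂ : ℕ} (E : Fin n → Fin m₂ → ℂ) (k : Fin m₂) :
    Set (Fin n) :=
  {i | mulVecF (dft n) (fun r => E r k) i ≠ 0}

/-- `Ĵ_k = J_k \ ⋃_{k' ≠ k} J_{k'}`: the passband of the `k`-th sub-band. -/
noncomputable def passband {n m₂ : ℕ} (E : Fin n → Fin m₂ → ℂ) (k : Fin m₂) : Set (Fin n) :=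
  subbandSupport E k \ ⋃ k' ∈ {k' : Fin m₂ | k' ≠ k}, subbandSupport E k'

/-- The number of nonzero entries (`ℓ₀` "norm") of a vector. -/
noncomputable def sparsity {m : ℕ} (x : Fin m → ℂ) : ℕ := {j | x j ≠ 0}.ncard

/-- The entries of the DFT matrix are powers of a primitive root of unity. -/
lemma exists_dft_eq_pow {n : ℕ} [NeZero n] :
    ∃ s ζ : ℂ, s ≠ 0 ∧ IsPrimitiveRoot ζ n ∧
      ∀ j k : Fin n, dft n j k = s * ζ ^ ((j : ℕ) * (k : ℕ)) := by
  refine ⟨((Real.sqrt n : ℝ) : ℂ)⁻¹, (Complex.exp (2 * Real.pi * Complex.I / n))⁻¹, ?_,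
    (Complex.isPrimitiveRoot_exp n (NeZero.ne n)).inv, fun j k => ?_⟩
  · have : (0 : ℝ) < n := Nat.cast_pos.2 (NeZero.pos n)
    exact inv_ne_zero (by exact_mod_cast (Real.sqrt_pos.2 this).ne')
  · rw [dft, ← Complex.exp_neg, ← Complex.exp_nat_mul]
    congr 2
    push_cast
    ring

/-- The DFT turns circular convolution into pointwise multiplication, up to a nonzero factor. -/
lemma exists_mul_dft_cconv {n : ℕ} [NeZero n] :
    ∃ s : ℂ, ∀ (u v : Fin n → ℂ) (i : Fin n),
      s * mulVecF (dft n) (cconv u v) i = mulVecF (dft n) u i * mulVecF (dft n) v i := by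
  obtain ⟨s, ζ, -, hζ, h⟩ := exists_dft_eq_pow (n := n)
  refine ⟨s, fun u v i => ?_⟩
  have hadd : ∀ a j : Fin n, s * dft n i (a + j) = dft n i j * dft n i a := fun a j => by
    have : ζ ^ ((i : ℕ) * ((a + j : Fin n) : ℕ)) = ζ ^ ((i : ℕ) * ((a : ℕ) + (j : ℕ))) := by
      rw [Fin.val_add]
      rw [mul_comm, pow_mul, mul_comm (i : ℕ), pow_mul ζ (_ + _), ← pow_mod_orderOf ζ (_ + _),
        ← hζ.eq_orderOf]
    rw [h, h, h, this, mul_add, pow_add]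
    ring
  simp only [mulVecF, cconv]
  rw [Finset.sum_mul_sum]
  simp_rw [Finset.mul_sum]
  rw [Finset.sum_comm]
  refine Finset.sum_congr rfl fun j _ => ?_
  rw [← Equiv.sum_comp (Equiv.addRight j)]
  refine Finset.sum_congr rfl fun a _ => ?_
  simp only [Equiv.coe_addRight, add_sub_cancel_right]
  linear_combination (u j * v a) * hadd a j

/-- The matrix product `F_n D`, as a linear function of `D`. -/
noncomputable def dftCols (n m : ℕ) : (Fin n → Fin m → ℂ) →ₗ[ℂ] (Fin n → Fin m → ℂ) where
  toFun D i j := ∑ r, dft n i r * D r j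
  map_add' A B := by
    ext i j
    simp [mul_add, Finset.sum_add_distrib]
  map_smul' c A := by
    ext i j
    simp [Finset.mul_sum, mul_left_comm]

lemma dftCols_surjective (n m : ℕ) [NeZero n] : Function.Surjective (dftCols n m) := by
  intro G
  obtain ⟨s, ζ, hs, hζ, h⟩ := exists_dft_eq_pow (n := n)
  have hF : Matrix.of (dft n) = s • Matrix.vandermonde (fun j : Fin n => ζ ^ (j : ℕ)) := by
    ext j k
    simp [h, Matrix.vandermonde_apply, pow_mul]
  have hdet : IsUnit (Matrix.of (dft n)).det := by
    rw [isUnit_iff_ne_zero, hF, Matrix.det_smul]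
    refine mul_ne_zero (pow_ne_zero _ hs) (Matrix.det_vandermonde_ne_zero_iff.2 ?_)
    intro a b hab
    exact Fin.ext (hζ.pow_inj a.2 b.2 hab)
  refine ⟨(Matrix.of (dft n))⁻¹ * Matrix.of G, ?_⟩
  have := Matrix.mul_nonsing_inv_cancel_left (Matrix.of (dft n)) (Matrix.of G) hdet
  ext i j
  exact congrFun (congrFun this i) j

lemma mulVecF_dft_mulVecF {n m : ℕ} (D : Fin n → Fin m → ℂ) (x : Fin m → ℂ) (i : Fin n) :
    mulVecF (dft n) (mulVecF D x) i = ∑ j, dftCols n m D i j * x j := by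
  simp only [mulVecF, dftCols, LinearMap.coe_mk, AddHom.coe_mk, Finset.mul_sum, Finset.sum_mul]
  rw [Finset.sum_comm]
  simp only [mul_assoc]

lemma mulVecF_dft_mulVecF_of_mem_passband {n m₂ : ℕ} (E : Fin n → Fin m₂ → ℂ) (y : Fin m₂ → ℂ)
    {i : Fin n} {k : Fin m₂} (hi : i ∈ passband E k) :
    mulVecF (dft n) (mulVecF E y) i = dftCols n m₂ E i k * y k := by
  rw [mulVecF_dft_mulVecF]
  refine Finset.sum_eq_single k (fun k' _ hk' => ?_) (by simp)
  have h : i ∉ subbandSupport E k' := fun hmem => hi.2 (Set.mem_biUnion hk' hmem)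
  have h' : dftCols n m₂ E i k' = 0 := not_not.1 h
  rw [h', zero_mul]

lemma dftCols_ne_zero_of_mem_passband {n m₂ : ℕ} {E : Fin n → Fin m₂ → ℂ}
    {i : Fin n} {k : Fin m₂} (hi : i ∈ passband E k) : dftCols n m₂ E i k ≠ 0 :=
  hi.1

lemma eq_of_mem_passband {n m₂ : ℕ} {E : Fin n → Fin m₂ → ℂ} {i : Fin n} {k k' : Fin m₂}
    (h : i ∈ passband E k) (h' : i ∈ passband E k') : k = k' := by
  by_contra hne
  exact h.2 (Set.mem_biUnion (show k' ∈ {k' | k' ≠ k} from Ne.symm hne) h'.1)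

/-- A linear family of square matrices with one invertible member is almost everywhere
invertible. -/
lemma ae_det_ne_zero {V ι : Type*} [NormedAddCommGroup V] [NormedSpace ℂ V] [MeasurableSpace V]
    [BorelSpace V] [FiniteDimensional ℂ V] (μ : Measure V) [μ.IsAddHaarMeasure] [Fintype ι]
    [DecidableEq ι] (M : V →ₗ[ℂ] Matrix ι ι ℂ) (A : V) (hA : (M A).det ≠ 0) :
    ∀ᵐ B ∂μ, (M B).det ≠ 0 := by
  have : LocallyCompactSpace V := by
    have := FiniteDimensional.proper ℂ V
    infer_instance
  have hcont : Continuous fun B => (M B).det :=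
    (M.continuous_of_finiteDimensional).matrix_det
  have hmeas : MeasurableSet {B | (M B).det ≠ 0} :=
    (isOpen_ne_fun hcont continuous_const).measurableSet
  refine ae_mem_of_ae_add_linearMap_mem (LinearMap.toSpanSingleton ℂ V A)
    (volume : Measure ℂ) μ hmeas fun B => ?_
  set P := (-((M A)⁻¹ * M B)).charpoly
  have hfin : {t : ℂ | P.IsRoot t}.Finite :=
    Polynomial.finite_setOfPred_isRoot (Matrix.charpoly_monic _).ne_zero
  have hae : ∀ᵐ t : ℂ, t ∉ {t : ℂ | P.IsRoot t} :=
    measure_eq_zero_iff_ae_notMem.1 (hfin.measure_zero _)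
  filter_upwards [hae] with t ht hdet
  apply ht
  have hfac : M (B + LinearMap.toSpanSingleton ℂ V A t)
      = M A * (Matrix.scalar ι t - -((M A)⁻¹ * M B)) := by
    rw [sub_neg_eq_add, mul_add, Matrix.mul_nonsing_inv_cancel_left _ _ (isUnit_iff_ne_zero.2 hA)]
    simp [add_comm, ← Matrix.smul_one_eq_diagonal]
  rw [hfac, Matrix.det_mul] at hdet
  show P.eval t = 0
  rw [Matrix.eval_charpoly]
  exact (mul_eq_zero.1 hdet).resolve_left hA

instance isAddHaarMeasure_volume_matrix (n m : ℕ) :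
    (volume : Measure (Fin n → Fin m → ℂ)).IsAddHaarMeasure :=
  Measure.pi.isAddHaarMeasure _

lemma ae_dftCols_sum_ne_zero {n m : ℕ} [NeZero n] {x₀ : Fin m → ℂ} (hx₀ : x₀ ≠ 0) (i : Fin n) :
    ∀ᵐ D : Fin n → Fin m → ℂ, ∑ j, dftCols n m D i j * x₀ j ≠ 0 := by
  obtain ⟨j₀, hj₀⟩ := Function.ne_iff.1 hx₀
  let M : (Fin n → Fin m → ℂ) →ₗ[ℂ] Matrix Unit Unit ℂ :=
    { toFun := fun D => Matrix.of fun _ _ => ∑ j, dftCols n m D i j * x₀ j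
      map_add' := fun A B => by
        ext
        simp [add_mul, Finset.sum_add_distrib]
      map_smul' := fun c A => by
        ext
        simp [Finset.mul_sum, mul_assoc] }
  obtain ⟨A, hA⟩ := dftCols_surjective n m fun _ => Pi.single j₀ 1
  have := ae_det_ne_zero volume M A (by simpa [M, hA, Pi.single_apply] using hj₀)
  simpa [M] using this

/-- One can choose a frequency in each passband, together with `u` further frequencies in
the union of the passbands. -/
lemma exists_frequencies {n m₂ u : ℕ} {E : Fin n → Fin m₂ → ℂ}
    (hsubband : ∀ k, (passband E k).Nonempty)
    (hu : u + m₂ ≤ ∑ k, (passband E k).ncard) {α : Type*} [Fintype α] (hα : Fintype.card α = u) :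
    ∃ (ρ : α ⊕ Fin m₂ → Fin n) (κ : α ⊕ Fin m₂ → Fin m₂), Function.Injective ρ ∧
      (∀ a, ρ a ∈ passband E (κ a)) ∧ ∀ k, κ (.inr k) = k := by
  classical
  choose f hf using hsubband
  have hfinj : Function.Injective f := fun a b hab =>
    eq_of_mem_passband (hf a) (hab ▸ hf b)
  let S : Finset (Fin n) := Finset.univ.biUnion fun k => (passband E k).toFinset
  have hS : S.card = ∑ k, (passband E k).ncard := by
    rw [Finset.card_biUnion]
    · simp [Set.ncard_eq_toFinset_card']
    · intro k _ k' _ hne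
      refine Finset.disjoint_left.2 fun i hi hi' => ?_
      exact hne (eq_of_mem_passband (Set.mem_toFinset.1 hi) (Set.mem_toFinset.1 hi'))
  let R := S \ Finset.univ.image f
  have hR : u ≤ R.card := by
    have h1 := Finset.le_card_sdiff (Finset.univ.image f) S
    have h2 : (Finset.univ.image f).card = m₂ := by
      rw [Finset.card_image_of_injective _ hfinj, Finset.card_fin]
    rw [h2, hS] at h1
    exact (Nat.le_sub_of_add_le hu).trans h1
  obtain ⟨e⟩ : Nonempty (α ↪ R) :=
    Function.Embedding.nonempty_of_card_le (by simpa [hα] using hR)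
  have hmem : ∀ a, ∃ k, (e a : Fin n) ∈ passband E k := fun a => by
    simpa [S] using (Finset.mem_sdiff.1 (e a).2).1
  choose g hg using hmem
  refine ⟨Sum.elim (fun a => e a) f, Sum.elim g id, ?_, ?_, fun _ => rfl⟩
  · refine Function.Injective.sumElim (Subtype.val_injective.comp e.injective) hfinj ?_
    intro a k h
    exact (Finset.mem_sdiff.1 (e a).2).2 (h ▸ Finset.mem_image_of_mem f (Finset.mem_univ k))
  · rintro (a | k)
    · exact hg a
    · exact hf k

/-- For almost all `D`, the linear system in `(x, c)` obtained by restricting to the passbands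
has only the trivial solution with `x` supported in `U \ {j₀}`. -/
lemma ae_passband_system_injective {n m₁ m₂ : ℕ} [NeZero n] {E : Fin n → Fin m₂ → ℂ}
    (hsubband : ∀ k, (passband E k).Nonempty) {x₀ : Fin m₁ → ℂ} {j₀ : Fin m₁} (hj₀ : x₀ j₀ ≠ 0)
    (U : Finset (Fin m₁)) (hU : (U.erase j₀).card + m₂ ≤ ∑ k, (passband E k).ncard) :
    ∀ᵐ D : Fin n → Fin m₁ → ℂ, ∀ (x : Fin m₁ → ℂ) (c : Fin m₂ → ℂ),
      (∀ j ∉ U.erase j₀, x j = 0) →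
      (∀ k, ∀ i ∈ passband E k, ∑ j, dftCols n m₁ D i j * x j
        = c k * ∑ j, dftCols n m₁ D i j * x₀ j) →
      x = 0 ∧ c = 0 := by
  obtain ⟨ρ, κ, hρ, hmem, hκ⟩ := exists_frequencies hsubband hU
    (α := {j // j ∈ U.erase j₀}) (Fintype.card_coe _)
  let M : (Fin n → Fin m₁ → ℂ) →ₗ[ℂ]
      Matrix ({j // j ∈ U.erase j₀} ⊕ Fin m₂) ({j // j ∈ U.erase j₀} ⊕ Fin m₂) ℂ :=
    { toFun := fun D => Matrix.of fun a => Sum.elim (fun j => dftCols n m₁ D (ρ a) j)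
        (fun k => if κ a = k then -∑ j, dftCols n m₁ D (ρ a) j * x₀ j else 0)
      map_add' := fun A B => by
        ext a (j | k)
        · simp
        · by_cases h : κ a = k <;> simp [h, add_mul, Finset.sum_add_distrib, add_comm]
      map_smul' := fun t A => by
        ext a (j | k)
        · simp
        · by_cases h : κ a = k <;> simp [h, Finset.mul_sum, mul_assoc] }
  have hM : ∀ D a v, (M D).mulVec v a = ∑ j : {j // j ∈ U.erase j₀},
      dftCols n m₁ D (ρ a) j * v (.inl j)
        - v (.inr (κ a)) * ∑ j, dftCols n m₁ D (ρ a) j * x₀ j := by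
    intro D a v
    simp [M, Matrix.mulVec, dotProduct, Fintype.sum_sum_type, sub_eq_add_neg, mul_comm]
  obtain ⟨A, hA⟩ := dftCols_surjective n m₁
    (Function.extend ρ (Sum.elim (fun j => Pi.single (j : Fin m₁) 1) fun _ => Pi.single j₀ 1) 0)
  have hAl : ∀ j, dftCols n m₁ A (ρ (.inl j)) = Pi.single (j : Fin m₁) 1 := fun j => by
    rw [hA, hρ.extend_apply]; rfl
  have hAr : ∀ k, dftCols n m₁ A (ρ (.inr k)) = Pi.single j₀ 1 := fun k => by
    rw [hA, hρ.extend_apply]; rfl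
  have hdet : (M A).det ≠ 0 := by
    intro h0
    obtain ⟨v, hv, hv0⟩ := Matrix.exists_mulVec_eq_zero_iff.2 h0
    have hr : ∀ k, v (.inr k) = 0 := fun k => by
      have := congrFun hv0 (.inr k)
      rw [hM, hAr, hκ, Finset.sum_eq_zero fun j _ => by
        rw [Pi.single_eq_of_ne (Finset.ne_of_mem_erase j.2), zero_mul]] at this
      simpa [Pi.single_apply, hj₀] using this
    apply hv
    ext (j | k)
    · have := congrFun hv0 (.inl j)
      rw [hM, hAl, hr, zero_mul, sub_zero, Finset.sum_eq_single j (fun b _ hb => by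
        rw [Pi.single_eq_of_ne (fun h => hb (Subtype.ext h)), zero_mul]) (by simp)] at this
      simpa using this
    · exact hr k
  filter_upwards [ae_det_ne_zero volume M A hdet] with D hD x c hx hc
  have hv : Sum.elim (fun j : {j // j ∈ U.erase j₀} => x j) c = 0 := by
    refine Matrix.eq_zero_of_mulVec_eq_zero hD ?_
    ext a
    rw [hM, Pi.zero_apply, sub_eq_zero]
    refine Eq.trans ?_ (hc (κ a) (ρ a) (hmem a))
    refine (Finset.sum_coe_sort (U.erase j₀) fun j => dftCols n m₁ D (ρ a) j * x j).trans ?_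
    exact Finset.sum_subset (Finset.subset_univ _) fun j _ hj => by rw [hx j hj, mul_zero]
  constructor
  · ext j
    by_cases hj : j ∈ U.erase j₀
    · exact congrFun hv (.inl ⟨j, hj⟩)
    · exact hx j hj
  · ext k
    exact congrFun hv (.inr k)

/-- Theorem 4.3: with a sub-band structured basis `E` whose bandwidths satisfy
`∑ ℓ_k ≥ 2s₁ + m₂ − 1`, an `s₁`-sparse nonzero `x₀` and a non-vanishing `y₀` are
identifiable up to scaling, among `s₁`-sparse `x`, for almost all `D`. -/
theorem subband_sparse_identifiability {n m₁ m₂ s₁ : ℕ}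
    (E : Fin n → Fin m₂ → ℂ)
    (hsubband : ∀ k, (passband E k).Nonempty)
    (hbw : 2 * s₁ + m₂ - 1 ≤ ∑ k, (passband E k).ncard)
    (x₀ : Fin m₁ → ℂ) (hx₀s : sparsity x₀ ≤ s₁) (hx₀ : x₀ ≠ 0)
    (y₀ : Fin m₂ → ℂ) (hy₀ : ∀ k, y₀ k ≠ 0) :
    ∀ᵐ D : Fin n → Fin m₁ → ℂ ∂volume,
      ∀ x : Fin m₁ → ℂ, ∀ y : Fin m₂ → ℂ, sparsity x ≤ s₁ →
        cconv (mulVecF D x) (mulVecF E y) = cconv (mulVecF D x₀) (mulVecF E y₀) →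
        ∃ σ : ℂ, σ ≠ 0 ∧ x = σ • x₀ ∧ y = σ⁻¹ • y₀ := by
  classical
  obtain ⟨j₀, hj₀⟩ := Function.ne_iff.1 hx₀
  rw [Pi.zero_apply] at hj₀
  have hs₁ : 0 < s₁ := lt_of_lt_of_le
    ((Set.ncard_pos (s := {j | x₀ j ≠ 0})).2 ⟨j₀, hj₀⟩) hx₀s
  obtain ⟨k₀⟩ : Nonempty (Fin m₂) := by
    rcases Nat.eq_zero_or_pos m₂ with rfl | h
    · rw [Finset.univ_eq_empty, Finset.sum_empty] at hbw
      omega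
    · exact ⟨⟨0, h⟩⟩
  have : NeZero n := ⟨by
    rintro rfl
    exact (hsubband k₀).some.elim0⟩
  obtain ⟨s, hs⟩ := exists_mul_dft_cconv (n := n)
  have hsys : ∀ᵐ D : Fin n → Fin m₁ → ℂ, ∀ U : Finset (Fin m₁),
      (U.erase j₀).card + m₂ ≤ ∑ k, (passband E k).ncard →
      ∀ (x : Fin m₁ → ℂ) (c : Fin m₂ → ℂ), (∀ j ∉ U.erase j₀, x j = 0) →
      (∀ k, ∀ i ∈ passband E k, ∑ j, dftCols n m₁ D i j * x j
        = c k * ∑ j, dftCols n m₁ D i j * x₀ j) → x = 0 ∧ c = 0 := by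
    rw [ae_all_iff]
    intro U
    by_cases hU : (U.erase j₀).card + m₂ ≤ ∑ k, (passband E k).ncard
    · filter_upwards [ae_passband_system_injective hsubband hj₀ U hU] with D hD _
      exact hD
    · exact Filter.Eventually.of_forall fun D h => absurd h hU
  filter_upwards [hsys, ae_all_iff.2 fun i => ae_dftCols_sum_ne_zero (n := n) hx₀ i]
    with D hD hne x y hxs hxy
  have key : ∀ k, ∀ i ∈ passband E k, (∑ j, dftCols n m₁ D i j * x j) * y k
      = (∑ j, dftCols n m₁ D i j * x₀ j) * y₀ k := by
    intro k i hi
    have h := hs (mulVecF D x) (mulVecF E y) i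
    rw [hxy, hs, mulVecF_dft_mulVecF_of_mem_passband E _ hi,
      mulVecF_dft_mulVecF_of_mem_passband E _ hi, mulVecF_dft_mulVecF, mulVecF_dft_mulVecF] at h
    apply mul_left_cancel₀ (dftCols_ne_zero_of_mem_passband hi)
    linear_combination -h
  have hy : ∀ k, y k ≠ 0 := by
    intro k h0
    obtain ⟨i, hi⟩ := hsubband k
    have h := key k i hi
    rw [h0, mul_zero] at h
    exact mul_ne_zero (hne i) (hy₀ k) h.symm
  let U : Finset (Fin m₁) := Finset.univ.filter (fun j => x j ≠ 0) ∪
    Finset.univ.filter (fun j => x₀ j ≠ 0)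
  have hUcard : (U.erase j₀).card + m₂ ≤ ∑ k, (passband E k).ncard := by
    have hmem : j₀ ∈ U := Finset.mem_union_right _ (by simpa using hj₀)
    have h1 : U.card ≤ s₁ + s₁ := by
      refine (Finset.card_union_le _ _).trans (add_le_add ?_ ?_)
      · simpa [sparsity, Set.ncard_eq_toFinset_card'] using hxs
      · simpa [sparsity, Set.ncard_eq_toFinset_card'] using hx₀s
    rw [Finset.card_erase_of_mem hmem]
    omega
  set σ := x j₀ / x₀ j₀ with hσ
  obtain ⟨hx0, hc0⟩ := hD U hUcard (x - σ • x₀) (fun k => y₀ k / y k - σ) (by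
    intro j hj
    by_cases hjj : j = j₀
    · subst hjj
      simp [hσ, hj₀]
    · have : x j = 0 ∧ x₀ j = 0 := by simpa [U, hjj] using hj
      simp [this]) (by
    intro k i hi
    have h : ∑ j, dftCols n m₁ D i j * (x - σ • x₀) j
        = ∑ j, dftCols n m₁ D i j * x j - σ * ∑ j, dftCols n m₁ D i j * x₀ j := by
      rw [Finset.mul_sum, ← Finset.sum_sub_distrib]
      refine Finset.sum_congr rfl fun j _ => ?_
      simp only [Pi.sub_apply, Pi.smul_apply, smul_eq_mul]
      ring
    have hy' := hy k
    rw [h, sub_mul, sub_left_inj, div_mul_eq_mul_div, eq_div_iff hy', key k i hi, mul_comm])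
  have hcσ : ∀ k, y₀ k = σ * y k := fun k =>
    (div_eq_iff (hy k)).1 (sub_eq_zero.1 (congrFun hc0 k))
  have hσ0 : σ ≠ 0 := by
    intro h
    exact hy₀ k₀ (by rw [hcσ, h, zero_mul])
  refine ⟨σ, hσ0, sub_eq_zero.1 hx0, ?_⟩
  ext k
  rw [Pi.smul_apply, smul_eq_mul, hcσ, inv_mul_cancel_left₀ hσ0]
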